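/- arXiv:1306.5197 — 2 statements merged into one kernel-verified Lean document; each statement's English description precedes it below -/
import Mathlib

section
/- Weak maximum principle property for unbounded functions obeying a growth condition: Let Q ⊆ ℝ^{d+1} be a possibly unbounded open set, Σ ⊆ ∂_P Q an open subset, K a convex cone of C² functions on Q, and let φ be a C² function on Q with 0 < φ ≤ 1 on Q and with φ·w ∈ K whenever w ∈ K. Define the operator L̂ on C² functions v on Q by L̂v := φ·L(φ^{-1}v) (equivalently, L̂ := L + N with Nv := -[L,φ](φ^{-1}v), where [L,φ]w := L(φw) - φ·Lw). Suppose that L̂ has the weak maximum principle property on Q ∪ Σ for the functions in K that are bounded above, i.e., every w ∈ K with sup_Q w < ∞, L̂w ≤ 0 on Q, and w* ≤ 0 on ∂_P Q ∖ cl(Σ) satisfies w ≤ 0 on Q. Then every u ∈ K satisfying the growth condition u ≤ C(1 + φ^{-1}) on Q for some constant C ≥ 0, together with Lu ≤ 0 on Q and u* ≤ 0 on ∂_P Q ∖ cl(Σ), satisfies u ≤ 0 on Q. -/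
open Set Filter Topology

noncomputable section

/-- Points of space-time `ℝ^{d+1}`, written `P = (t, x)` with `t ∈ ℝ` and `x ∈ ℝ^d`. -/
abbrev Pt (d : ℕ) := ℝ × (Fin d → ℝ)

/-- Squared Euclidean norm on `ℝ^d`. -/
def enorm2 {d : ℕ} (x : Fin d → ℝ) : ℝ := ∑ i, x i ^ 2

/-- Euclidean inner product on `ℝ^d`. -/
def dotp {d : ℕ} (x y : Fin d → ℝ) : ℝ := ∑ i, x i * y i

/-- The parabolic cylinder `Q_R(P⁰)`. -/
def paraCyl {d : ℕ} (P0 : Pt d) (R : ℝ) : Set (Pt d) :=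
  {P | max (Real.sqrt (enorm2 (P.2 - P0.2))) (Real.sqrt |P.1 - P0.1|) < R ∧ P0.1 < P.1}

/-- The parabolic boundary `∂_P Q` of an open set `Q ⊂ ℝ^{d+1}`. -/
def paraBdry {d : ℕ} (Q : Set (Pt d)) : Set (Pt d) :=
  {P0 | P0 ∈ frontier Q ∧ ∀ ε > 0, (paraCyl P0 ε ∩ Q).Nonempty}

/-- Time derivative `u_t`. -/
def tDeriv {d : ℕ} (u : Pt d → ℝ) (P : Pt d) : ℝ := deriv (fun s => u (s, P.2)) P.1

/-- Spatial gradient `Du` (in the variables `x` only). -/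
def xGrad {d : ℕ} (u : Pt d → ℝ) (P : Pt d) : Fin d → ℝ :=
  fun i => fderiv ℝ (fun x => u (P.1, x)) P.2 (Pi.single i 1)

/-- Spatial Hessian `D²u` (in the variables `x` only). -/
def xHess {d : ℕ} (u : Pt d → ℝ) (P : Pt d) : Matrix (Fin d) (Fin d) ℝ :=
  Matrix.of fun i j =>
    fderiv ℝ (fun x => fderiv ℝ (fun y => u (P.1, y)) x (Pi.single j 1)) P.2 (Pi.single i 1)

/-- The boundary-degenerate parabolic operator
`Lu = -u_t - tr(a D²u) - ⟨b, Du⟩ + c·u`. -/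
def Lop {d : ℕ} (a : Pt d → Matrix (Fin d) (Fin d) ℝ) (b : Pt d → Fin d → ℝ)
    (c : Pt d → ℝ) (u : Pt d → ℝ) (P : Pt d) : ℝ :=
  - tDeriv u P - Matrix.trace (a P * xHess u P) - dotp (b P) (xGrad u P) + c P * u P

/-- `u` is (parabolically) `C²` on the open set `Q`:  `u, u_t, Du, D²u` exist and are
continuous on `Q`. -/
structure IsParaC2On {d : ℕ} (u : Pt d → ℝ) (Q : Set (Pt d)) : Prop where
  cont : ContinuousOn u Q
  difft : ∀ P ∈ Q, DifferentiableAt ℝ (fun s => u (s, P.2)) P.1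
  diffx : ∀ P ∈ Q, DifferentiableAt ℝ (fun x => u (P.1, x)) P.2
  diffxx : ∀ P ∈ Q, DifferentiableAt ℝ (fun x => fderiv ℝ (fun y => u (P.1, y)) x) P.2
  contt : ContinuousOn (tDeriv u) Q
  contx : ContinuousOn (xGrad u) Q
  contxx : ContinuousOn (xHess u) Q

/-- Upper semicontinuous envelope `u*` of `u` relative to `Q`, `EReal`-valued. -/
def uscEnv {d : ℕ} (u : Pt d → ℝ) (Q : Set (Pt d)) (P : Pt d) : EReal :=
  Filter.limsup (fun P' => (u P' : EReal)) (𝓝[Q] P)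

/-- Lower semicontinuous envelope `u_*` of `u` relative to `Q`, `EReal`-valued. -/
def lscEnv {d : ℕ} (u : Pt d → ℝ) (Q : Set (Pt d)) (P : Pt d) : EReal :=
  Filter.liminf (fun P' => (u P' : EReal)) (𝓝[Q] P)

/-- `Q0` is a relatively open, `C^{1,α}`, degenerate boundary portion `∂₀Q` of `Q` for the
coefficient `a` (which vanishes continuously along `Q0`), with inward-pointing unit spatial
normal field `ν` (tangent to the time direction, i.e. `n₀ = 0` along `Q0`). -/
structure IsDegenBdry {d : ℕ} (Q : Set (Pt d)) (a : Pt d → Matrix (Fin d) (Fin d) ℝ)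
    (Q0 : Set (Pt d)) (ν : Pt d → Fin d → ℝ) (α : ℝ) : Prop where
  subset : Q0 ⊆ frontier Q
  relOpen : ∀ P ∈ Q0, ∃ V : Set (Pt d), IsOpen V ∧ P ∈ V ∧ frontier Q ∩ V ⊆ Q0
  aVanish : ∀ P ∈ Q0, Filter.Tendsto a (𝓝[Q] P) (𝓝 0)
  alpha_pos : 0 < α
  alpha_le_one : α ≤ 1
  unitNormal : ∀ P ∈ Q0, enorm2 (ν P) = 1
  inward : ∀ P ∈ Q0, ∀ᶠ s in 𝓝[>] (0 : ℝ), ((P.1, P.2 + s • ν P) : Pt d) ∈ Q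
  tangent : ∀ P ∈ Q0,
    Filter.Tendsto (fun P' : Pt d => dotp (P'.2 - P.2) (ν P) / dist P' P)
      (𝓝[frontier Q \ {P}] P) (𝓝 0)
  holder : ∃ C : ℝ, 0 ≤ C ∧ ∀ P ∈ Q0, ∀ P' ∈ Q0, dist (ν P) (ν P') ≤ C * dist P P' ^ α

/-- `u ∈ C²ₛ(Q̲)` where `Q̲ = Q ∪ Q0`:  `u` is parabolically `C²` on `Q`, `u` is continuous
on `Q̲`, the derivatives `u_t` and `Du` extend continuously to `Q̲`, and `tr(a D²u)` extends
continuously to `Q̲` with boundary value `0` on `Q0`. -/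
structure IsC2s {d : ℕ} (a : Pt d → Matrix (Fin d) (Fin d) ℝ) (u : Pt d → ℝ)
    (Q Q0 : Set (Pt d)) : Prop where
  paraC2 : IsParaC2On u Q
  contu : ContinuousOn u (Q ∪ Q0)
  tLim : ∀ P ∈ Q0, ∃ ℓ : ℝ, Filter.Tendsto (tDeriv u) (𝓝[Q] P) (𝓝 ℓ)
  xLim : ∀ P ∈ Q0, ∃ g : Fin d → ℝ, Filter.Tendsto (xGrad u) (𝓝[Q] P) (𝓝 g)
  trLim : ∀ P ∈ Q0,
    Filter.Tendsto (fun P' => Matrix.trace (a P' * xHess u P')) (𝓝[Q] P) (𝓝 (0 : ℝ))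

/-- `f` is locally bounded on `S`. -/
def LocBddOn {d : ℕ} {E : Type*} [SeminormedAddCommGroup E] (f : Pt d → E)
    (S : Set (Pt d)) : Prop :=
  ∀ P ∈ S, ∃ V ∈ 𝓝 P, ∃ M : ℝ, ∀ P' ∈ V ∩ S, ‖f P'‖ ≤ M

/-- Smallest eigenvalue `λ` of a symmetric matrix, via the Rayleigh quotient. -/
def minEig {d : ℕ} (A : Matrix (Fin d) (Fin d) ℝ) : ℝ :=
  sInf {r | ∃ v : Fin d → ℝ, enorm2 v = 1 ∧ dotp v (A.mulVec v) = r}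

/-- Interior local strict parabolicity: `λ_* > 0` on `Q`, where `λ_*` is the lower
semicontinuous envelope of the least-eigenvalue function of `a`. -/
def StrictlyParaOn {d : ℕ} (a : Pt d → Matrix (Fin d) (Fin d) ℝ) (Q : Set (Pt d)) : Prop :=
  ∀ P ∈ Q, 0 < Filter.liminf (fun P' => ((minEig (a P') : ℝ) : EReal)) (𝓝[Q] P)

/-- `S(P⁰)`: the set of points of `S` which can be connected to `P⁰` by a simple continuous
curve in `S` along which the time coordinate is non-increasing from `P` to `P⁰`. -/
def Spast {d : ℕ} (S : Set (Pt d)) (P0 : Pt d) : Set (Pt d) :=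
  {P | P ∈ S ∧ (P = P0 ∨ ∃ γ : ℝ → Pt d, ContinuousOn γ (Icc 0 1) ∧ InjOn γ (Icc 0 1) ∧
    MapsTo γ (Icc 0 1) S ∧ γ 0 = P ∧ γ 1 = P0 ∧
    ∀ s ∈ Icc (0:ℝ) 1, ∀ s' ∈ Icc (0:ℝ) 1, s ≤ s' → (γ s').1 ≤ (γ s).1)}

/-- `K` is a convex cone of (parabolically) `C²` functions on `Q`. -/
def IsConeOfC2 {d : ℕ} (K : Set (Pt d → ℝ)) (Q : Set (Pt d)) : Prop :=
  (∀ w ∈ K, IsParaC2On w Q) ∧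
    ∀ w₁ ∈ K, ∀ w₂ ∈ K, ∀ s t : ℝ, 0 ≤ s → 0 ≤ t → (fun P => s * w₁ P + t * w₂ P) ∈ K

/-- `Sg` is a (relatively) open subset of `base`. -/
def RelOpenIn {d : ℕ} (Sg base : Set (Pt d)) : Prop :=
  Sg ⊆ base ∧ ∀ P ∈ Sg, ∃ V : Set (Pt d), IsOpen V ∧ P ∈ V ∧ base ∩ V ⊆ Sg

/-- The weak maximum principle property of `L` on `Q ∪ Σ` for the cone `K`. -/
def WMPP {d : ℕ} (a : Pt d → Matrix (Fin d) (Fin d) ℝ) (b : Pt d → Fin d → ℝ)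
    (c : Pt d → ℝ) (Q Sg : Set (Pt d)) (K : Set (Pt d → ℝ)) : Prop :=
  ∀ w ∈ K, (∀ P ∈ Q, Lop a b c w P ≤ 0) →
    (∀ P ∈ paraBdry Q \ closure Sg, uscEnv w Q P ≤ 0) → ∀ P ∈ Q, w P ≤ 0

/-- The weak maximum principle property of `L` on `U ∪ Σ` for every open subdomain
`U ⊆ Q`, for the cone `K`. -/
def SubWMPP {d : ℕ} (a : Pt d → Matrix (Fin d) (Fin d) ℝ) (b : Pt d → Fin d → ℝ)
    (c : Pt d → ℝ) (Q Sg : Set (Pt d)) (K : Set (Pt d → ℝ)) : Prop :=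
  ∀ U : Set (Pt d), U ⊆ Q → IsOpen U → ∀ w ∈ K,
    (∀ P ∈ U, Lop a b c w P ≤ 0) →
    (∀ P ∈ paraBdry U \ closure Sg, uscEnv w U P ≤ 0) → ∀ P ∈ U, w P ≤ 0

/-- `L` is a local operator. -/
lemma Lop_congr_of_eventuallyEq {d : ℕ} (a : Pt d → Matrix (Fin d) (Fin d) ℝ)
    (b : Pt d → Fin d → ℝ) (c : Pt d → ℝ) {u v : Pt d → ℝ} {P : Pt d} (h : u =ᶠ[𝓝 P] v) :
    Lop a b c u P = Lop a b c v P := by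
  have ht : (fun s => u (s, P.2)) =ᶠ[𝓝 P.1] fun s => v (s, P.2) :=
    (Continuous.prodMk_left P.2).continuousAt.eventually h
  have hx : (fun x => u (P.1, x)) =ᶠ[𝓝 P.2] fun x => v (P.1, x) :=
    (Continuous.prodMk_right P.1).continuousAt.eventually h
  have hT : tDeriv u P = tDeriv v P := ht.deriv_eq
  have hG : xGrad u P = xGrad v P := by
    funext i
    simp only [xGrad, hx.fderiv_eq]
  have hH : xHess u P = xHess v P := by
    ext i j
    have hj : (fun x => fderiv ℝ (fun y => u (P.1, y)) x (Pi.single j 1)) =ᶠ[𝓝 P.2]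
        fun x => fderiv ℝ (fun y => v (P.1, y)) x (Pi.single j 1) :=
      (hx.fderiv (𝕜 := ℝ)).mono fun x hx' => by simp only [hx']
    simp only [xHess, Matrix.of_apply, hj.fderiv_eq]
  simp only [Lop, hT, hG, hH, h.eq_of_nhds]

/-- Multiplying by a factor with values in `[0, 1]` preserves nonpositivity of the upper
semicontinuous envelope. -/
lemma uscEnv_mul_nonpos {d : ℕ} {φ u : Pt d → ℝ} {Q : Set (Pt d)} {P : Pt d}
    (hφ₀ : ∀ P' ∈ Q, 0 ≤ φ P') (hφ₁ : ∀ P' ∈ Q, φ P' ≤ 1) (hu : uscEnv u Q P ≤ 0) :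
    uscEnv (fun P' => φ P' * u P') Q P ≤ 0 := by
  refine EReal.le_of_forall_lt_iff_le.1 fun ε hε => ?_
  have hev : ∀ᶠ P' in 𝓝[Q] P, (u P' : EReal) < ε :=
    eventually_lt_of_limsup_lt (hu.trans_lt hε)
  refine limsup_le_of_le (h := ?_)
  filter_upwards [hev, self_mem_nhdsWithin] with P' hP' hPQ
  have hε' : 0 < ε := by exact_mod_cast hε
  have hlt : u P' < ε := by exact_mod_cast hP'
  have : φ P' * u P' ≤ ε := by nlinarith [hφ₀ P' hPQ, hφ₁ P' hPQ]
  exact_mod_cast this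

/-- Weak maximum principle property for unbounded functions obeying a growth
condition (Theorem 2.11). -/
theorem wmpp_unbounded_functions_growth_condition
    {d : ℕ} (hd : 1 ≤ d) (Q Sg : Set (Pt d))
    (a : Pt d → Matrix (Fin d) (Fin d) ℝ) (b : Pt d → Fin d → ℝ) (c : Pt d → ℝ)
    (hQ : IsOpen Q) (ha : ∀ P ∈ Q, (a P).PosSemidef)
    (hSg : RelOpenIn Sg (paraBdry Q))
    (K : Set (Pt d → ℝ)) (hK : IsConeOfC2 K Q)
    (φ : Pt d → ℝ) (hφC2 : IsParaC2On φ Q)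
    (hφpos : ∀ P ∈ Q, 0 < φ P) (hφle : ∀ P ∈ Q, φ P ≤ 1)
    (hφK : ∀ w ∈ K, (fun P => φ P * w P) ∈ K)
    -- `L̂ := φ · L(φ⁻¹ ·)` has the weak maximum principle property on `Q ∪ Σ` for the
    -- functions in `K` which are bounded above:
    (hWMPhat : ∀ w ∈ K, BddAbove (w '' Q) →
      (∀ P ∈ Q, φ P * Lop a b c (fun P' => (φ P')⁻¹ * w P') P ≤ 0) →
      (∀ P ∈ paraBdry Q \ closure Sg, uscEnv w Q P ≤ 0) → ∀ P ∈ Q, w P ≤ 0) :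
    ∀ u ∈ K, ∀ C : ℝ, 0 ≤ C → (∀ P ∈ Q, u P ≤ C * (1 + (φ P)⁻¹)) →
      (∀ P ∈ Q, Lop a b c u P ≤ 0) →
      (∀ P ∈ paraBdry Q \ closure Sg, uscEnv u Q P ≤ 0) →
      ∀ P ∈ Q, u P ≤ 0 := by
  intro u hu C hC hgrowth hLu hbdry P hP
  have hinv : ∀ P' ∈ Q, φ P' * (φ P')⁻¹ = 1 := fun P' h => mul_inv_cancel₀ (hφpos P' h).ne'
  have hbdd : BddAbove ((fun P' => φ P' * u P') '' Q) := by
    refine ⟨2 * C, ?_⟩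
    rintro _ ⟨P', hP', rfl⟩
    calc φ P' * u P' ≤ φ P' * (C * (1 + (φ P')⁻¹)) :=
          mul_le_mul_of_nonneg_left (hgrowth P' hP') (hφpos P' hP').le
      _ = C * φ P' + C * (φ P' * (φ P')⁻¹) := by ring
      _ ≤ 2 * C := by nlinarith [hinv P' hP', hφle P' hP']
  have hL : ∀ P' ∈ Q,
      φ P' * Lop a b c (fun P'' => (φ P'')⁻¹ * (φ P'' * u P'')) P' ≤ 0 := by
    intro P' hP'
    have heq : (fun P'' => (φ P'')⁻¹ * (φ P'' * u P'')) =ᶠ[𝓝 P'] u := by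
      filter_upwards [hQ.mem_nhds hP'] with P'' hP''
      exact inv_mul_cancel_left₀ (hφpos P'' hP'').ne' _
    rw [Lop_congr_of_eventuallyEq a b c heq]
    exact mul_nonpos_of_nonneg_of_nonpos (hφpos P' hP').le (hLu P' hP')
  have hw : φ P * u P ≤ 0 := hWMPhat _ (hφK u hu) hbdd hL
    (fun P' hP' => uscEnv_mul_nonpos (fun P'' h => (hφpos P'' h).le) hφle (hbdry P' hP')) P hP
  exact nonpos_of_mul_nonpos_right hw (hφpos P hP)
end
end

section
/- A special case of the strong maximum principle: Let Q ⊂ ℝ^{d+1} be open with ∂₀Q of class C^{1,α}. Assume b^⊥ ≥ 0 on ∂₀Q, c ≥ 0 on Q, and c ≥ 0 on ∂₀Q. Suppose u ∈ C²_s(Q̲) and that either (i) Lu < 0 on Q̲ (using the continuous extension of Lu to Q̲), or (ii) Lu ≤ 0 on Q and c > 0 on Q̲. Then u cannot have a positive maximum in Q̲; that is, there is no point P⁰ ∈ Q̲ with u(P⁰) > 0 and u(P) ≤ u(P⁰) for all P ∈ Q̲. -/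
open Set Filter Topology

noncomputable section

/-- A function with a local maximum has nonpositive second derivative there. -/
theorem IsLocalMax.deriv_deriv_nonpos {g : ℝ → ℝ} {x : ℝ} (h : IsLocalMax g x)
    (hc : ContinuousAt g x) : deriv (deriv g) x ≤ 0 := by
  by_contra! hpos
  have hmin := isLocalMin_of_deriv_deriv_pos hpos h.deriv_eq_zero hc
  have hconst : g =ᶠ[𝓝 x] fun _ => g x := by
    filter_upwards [h, hmin] with y h₁ h₂ using le_antisymm h₁ h₂
  simp [hconst.deriv.deriv_eq] at hpos

/-- A preconnected set that meets an open set but not its frontier lies in the open set. -/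
theorem IsPreconnected.subset_of_disjoint_frontier {X : Type*} [TopologicalSpace X] {s U : Set X}
    (hs : IsPreconnected s) (hU : IsOpen U) (hne : (s ∩ U).Nonempty)
    (hd : ∀ x ∈ s, x ∉ frontier U) : s ⊆ U := by
  refine hs.subset_left_of_subset_union hU isClosed_closure.isOpen_compl
    (disjoint_compl_right_iff_subset.2 subset_closure) (fun x hx => ?_) hne
  by_contra hx'
  simp only [mem_union, mem_compl_iff, not_or, not_not] at hx'
  exact hd x hx (by rw [hU.frontier_eq]; exact ⟨hx'.2, hx'.1⟩)

theorem dotp_add_left {d : ℕ} (x y z : Fin d → ℝ) : dotp (x + y) z = dotp x z + dotp y z := by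
  simp [dotp, add_mul, Finset.sum_add_distrib]

theorem dotp_smul_left {d : ℕ} (r : ℝ) (x y : Fin d → ℝ) : dotp (r • x) y = r * dotp x y := by
  simp [dotp, Finset.mul_sum, mul_assoc]

theorem dotp_self {d : ℕ} (x : Fin d → ℝ) : dotp x x = enorm2 x := by
  simp [dotp, enorm2, sq]

theorem tendsto_dotp {d : ℕ} {β : Type*} {l : Filter β} {f g : β → Fin d → ℝ} {x y : Fin d → ℝ}
    (hf : Tendsto f l (𝓝 x)) (hg : Tendsto g l (𝓝 y)) :
    Tendsto (fun p => dotp (f p) (g p)) l (𝓝 (dotp x y)) :=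
  tendsto_finsetSum _ fun i _ => (tendsto_pi_nhds.1 hf i).mul (tendsto_pi_nhds.1 hg i)

/-- A linear functional on `ℝ^d` in coordinates. -/
theorem clm_apply_eq_sum {d : ℕ} (φ : (Fin d → ℝ) →L[ℝ] ℝ) (v : Fin d → ℝ) :
    φ v = ∑ i, v i * φ (Pi.single i 1) := by
  conv_lhs => rw [pi_eq_sum_univ' v]
  simp only [map_sum, map_smul, smul_eq_mul]

theorem fderiv_apply_eq_dotp_xGrad {d : ℕ} (u : Pt d → ℝ) (P : Pt d) (v : Fin d → ℝ) :
    fderiv ℝ (fun x => u (P.1, x)) P.2 v = dotp v (xGrad u P) :=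
  clm_apply_eq_sum _ v

section Interior

variable {d : ℕ} {Q : Set (Pt d)} {u : Pt d → ℝ} {P : Pt d}

theorem tDeriv_eq_zero_of_isLocalMax (h : IsLocalMax u P) : tDeriv u P = 0 := by
  refine IsLocalMax.deriv_eq_zero ?_
  have hc : ContinuousAt (fun s : ℝ => ((s, P.2) : Pt d)) P.1 := by fun_prop
  exact hc.tendsto.eventually h

theorem xGrad_eq_zero_of_isLocalMax (h : IsLocalMax u P) : xGrad u P = 0 := by
  have hc : ContinuousAt (fun x : Fin d → ℝ => ((P.1, x) : Pt d)) P.2 := by fun_prop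
  have : IsLocalMax (fun x => u (P.1, x)) P.2 := hc.tendsto.eventually h
  ext i
  simp [xGrad, this.fderiv_eq_zero]

/-- The spatial Hessian is negative semidefinite at a local maximum. -/
theorem xHess_nonpos_of_isLocalMax (hQ : IsOpen Q) (hu : IsParaC2On u Q) (hP : P ∈ Q)
    (h : IsLocalMax u P) (v : Fin d → ℝ) : ∑ i, ∑ j, v i * v j * xHess u P i j ≤ 0 := by
  set f : (Fin d → ℝ) → ℝ := fun x => u (P.1, x) with hf
  set γ : ℝ → Fin d → ℝ := fun s => P.2 + s • v with hγ
  have hγ0 : γ 0 = P.2 := by simp [hγ]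
  have hγd : ∀ s, HasDerivAt γ v s := fun s => by
    simpa [hγ] using ((hasDerivAt_id s).smul_const v).const_add P.2
  have hγc : Tendsto (fun s => ((P.1, γ s) : Pt d)) (𝓝 0) (𝓝 P) := by
    have : Continuous (fun s => ((P.1, γ s) : Pt d)) := by fun_prop
    simpa [hγ0] using this.tendsto 0
  have hmax : IsLocalMax (f ∘ γ) 0 := by
    have := hγc.eventually h
    simpa [IsLocalMax, IsMaxFilter, hf, hγ0] using this
  have hderiv : deriv (f ∘ γ) =ᶠ[𝓝 0] fun s => fderiv ℝ f (γ s) v := by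
    filter_upwards [hγc.eventually (hQ.mem_nhds hP)] with s hs
    exact ((hu.diffx _ hs).hasFDerivAt.comp_hasDerivAt s (hγd s)).deriv
  have hc : ContinuousAt (f ∘ γ) 0 := by
    refine ContinuousAt.comp ?_ (hγd 0).continuousAt
    rw [hγ0]
    exact (hu.diffx P hP).continuousAt
  have h2 := hmax.deriv_deriv_nonpos hc
  have hxx : HasFDerivAt (fderiv ℝ f) (fderiv ℝ (fderiv ℝ f) P.2) (γ 0) := by
    rw [hγ0]
    exact (hu.diffxx P hP).hasFDerivAt
  have hdd := ((hxx.comp_hasDerivAt (0 : ℝ) (hγd 0)).clm_apply (hasDerivAt_const (0 : ℝ) v)).deriv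
  rw [hderiv.deriv_eq] at h2
  have hdd' : deriv (fun s => fderiv ℝ f (γ s) v) 0 = fderiv ℝ (fderiv ℝ f) P.2 v v := by
    simpa [Function.comp_def] using hdd
  rw [hdd'] at h2
  have hH : ∀ i j, xHess u P i j
      = fderiv ℝ (fderiv ℝ f) P.2 (Pi.single i 1) (Pi.single j 1) := fun i j => by
    have := (hu.diffxx P hP).hasFDerivAt.clm_apply
      (hasFDerivAt_const (Pi.single j 1 : Fin d → ℝ) P.2)
    simp only [xHess, Matrix.of_apply]
    rw [this.fderiv]
    simp [hf]
  convert h2 using 1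
  have e1 : fderiv ℝ (fderiv ℝ f) P.2 v v
      = ∑ j, v j * ∑ i, v i * fderiv ℝ (fderiv ℝ f) P.2 (Pi.single i 1) (Pi.single j 1) := by
    rw [clm_apply_eq_sum (fderiv ℝ (fderiv ℝ f) P.2 v) v]
    refine Finset.sum_congr rfl fun j _ => ?_
    congr 1
    exact clm_apply_eq_sum ((fderiv ℝ (fderiv ℝ f) P.2).flip (Pi.single j 1)) v
  rw [e1, Finset.sum_comm]
  simp only [hH, Finset.mul_sum]
  exact Finset.sum_congr rfl fun j _ => Finset.sum_congr rfl fun i _ => by ring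

/-- `tr(AH) ≤ 0` if `A` is positive semidefinite and the quadratic form of `H` is nonpositive. -/
theorem Matrix.PosSemidef.trace_mul_nonpos {A H : Matrix (Fin d) (Fin d) ℝ} (hA : A.PosSemidef)
    (hH : ∀ v : Fin d → ℝ, ∑ i, ∑ j, v i * v j * H i j ≤ 0) : Matrix.trace (A * H) ≤ 0 := by
  obtain ⟨m, v, rfl⟩ := Matrix.posSemidef_iff_eq_sum_vecMulVec.1 hA
  rw [Finset.sum_mul, Matrix.trace_sum]
  refine Finset.sum_nonpos fun k _ => ?_
  refine le_of_eq_of_le ?_ (hH (v k))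
  simp only [Matrix.trace, Matrix.diag_apply, Matrix.mul_apply, Matrix.vecMulVec_apply, star_trivial]
  rw [Finset.sum_comm]
  exact Finset.sum_congr rfl fun j _ => Finset.sum_congr rfl fun i _ => by ring

/-- At an interior local maximum, `Lu ≥ cu`. -/
theorem mul_le_Lop_of_isLocalMax {a : Pt d → Matrix (Fin d) (Fin d) ℝ} {b : Pt d → Fin d → ℝ}
    {c : Pt d → ℝ} (hQ : IsOpen Q) (hu : IsParaC2On u Q) (hP : P ∈ Q) (ha : (a P).PosSemidef)
    (h : IsLocalMax u P) : c P * u P ≤ Lop a b c u P := by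
  have := ha.trace_mul_nonpos (xHess_nonpos_of_isLocalMax hQ hu hP h)
  simp only [Lop, tDeriv_eq_zero_of_isLocalMax h, xGrad_eq_zero_of_isLocalMax h]
  simp only [dotp, Pi.zero_apply, mul_zero, Finset.sum_const_zero]
  linarith

/-- Differentiability of `u` in all the variables, along a line. -/
theorem IsParaC2On.hasDerivAt_line (hQ : IsOpen Q) (hu : IsParaC2On u Q) {w : Pt d} {s : ℝ}
    (hs : P + s • w ∈ Q) :
    HasDerivAt (fun r : ℝ => u (P + r • w))
      (w.1 * tDeriv u (P + s • w) + dotp w.2 (xGrad u (P + s • w))) s := by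
  set R : Pt d := P + s • w with hR
  have hQR := hQ.mem_nhds hs
  have hstrict := hasStrictFDerivAt_uncurry_coprod (𝕜 := ℝ) (u := R) (f := fun t x => u (t, x))
    (f₁ := fun t x => ContinuousLinearMap.toSpanSingleton ℝ (tDeriv u (t, x)))
    (f₂ := fun t x => fderiv ℝ (fun y => u (t, y)) x)
    (by
      filter_upwards [hQR] with v hv
      exact (hu.difft v hv).hasDerivAt.hasFDerivAt)
    (by
      filter_upwards [hQR] with v hv
      exact (hu.diffx v hv).hasFDerivAt)
    (by
      have hc : ContinuousAt (tDeriv u) R := hu.contt.continuousAt hQR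
      exact (ContinuousLinearMap.toSpanSingletonCLE (𝕜 := ℝ) (E := ℝ)).continuous.continuousAt.comp hc)
    (by
      have hc : ContinuousAt (xGrad u) R := hu.contx.continuousAt hQR
      have he : ↿(fun t x => fderiv ℝ (fun y => u (t, y)) x)
          = fun P : Pt d => ∑ i, xGrad u P i • ContinuousLinearMap.proj (R := ℝ) (φ := fun _ => ℝ) i := by
        ext P v
        change fderiv ℝ (fun y => u (P.1, y)) P.2 v = _
        rw [fderiv_apply_eq_dotp_xGrad]
        simp [dotp, mul_comm]
      rw [he]
      exact tendsto_finsetSum _ fun i _ => (tendsto_pi_nhds.1 hc i).smul_const _)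
  have hline : HasDerivAt (fun r : ℝ => P + r • w) w s := by
    simpa using ((hasDerivAt_id s).smul_const w).const_add P
  have := hstrict.hasFDerivAt.comp_hasDerivAt s hline
  rw [← fderiv_apply_eq_dotp_xGrad]
  exact this

end Interior

section Boundary

variable {d : ℕ} {Q Q0 : Set (Pt d)} {a : Pt d → Matrix (Fin d) (Fin d) ℝ} {ν : Pt d → Fin d → ℝ}
  {α : ℝ} {P : Pt d}

/-- Rays from a point of `Q0` pointing strictly to the side of the inward normal start in `Q`. -/
theorem IsDegenBdry.eventually_ray_mem (h : IsDegenBdry Q a Q0 ν α) (hQ : IsOpen Q) (hP : P ∈ Q0)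
    {w : Pt d} (hw : 0 < dotp w.2 (ν P)) : ∀ᶠ s in 𝓝[>] (0 : ℝ), P + s • w ∈ Q := by
  have hν : dotp (ν P) (ν P) = 1 := by rw [dotp_self, h.unitNormal P hP]
  set n : Pt d := (0, ν P) with hn
  set m : ℝ := min 1 (dotp w.2 (ν P))
  have hm : 0 < m := lt_min one_pos hw
  set M : ℝ := max ‖n‖ ‖w‖ + 1
  have hM : 0 < M := by positivity
  have hz : ∀ z ∈ segment ℝ n w, m ≤ dotp z.2 (ν P) ∧ ‖z‖ < M := by
    rintro z ⟨p, q, hp, hq, hpq, rfl⟩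
    constructor
    · have : dotp (p • n + q • w).2 (ν P) = p + q * dotp w.2 (ν P) := by
        rw [Prod.snd_add, Prod.smul_snd, Prod.smul_snd, dotp_add_left, dotp_smul_left,
          dotp_smul_left, hn, hν, mul_one]
      rw [this]
      calc m = p * m + q * m := by rw [← add_mul, hpq, one_mul]
        _ ≤ p * 1 + q * dotp w.2 (ν P) := by
          gcongr
          exacts [min_le_left _ _, min_le_right _ _]
        _ = _ := by ring
    · have hb : p • n + q • w ∈ Metric.closedBall (0 : Pt d) (max ‖n‖ ‖w‖) :=
        (convex_closedBall (0 : Pt d) _) (by simp) (by simp) hp hq hpq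
      rw [mem_closedBall_zero_iff] at hb
      exact hb.trans_lt (lt_add_one _)
  have htan := (h.tangent P hP).eventually (gt_mem_nhds (div_pos hm hM))
  rw [eventually_nhdsWithin_iff, Metric.eventually_nhds_iff] at htan
  obtain ⟨δ, hδ, htan⟩ := htan
  have hsmall : ∀ᶠ s in 𝓝[>] (0 : ℝ), s < δ / M :=
    nhdsWithin_le_nhds (gt_mem_nhds (div_pos hδ hM))
  filter_upwards [h.inward P hP, hsmall, self_mem_nhdsWithin] with s hsQ hsδ (hs0 : 0 < s)
  have hpre : IsPreconnected ((fun z : Pt d => P + s • z) '' segment ℝ n w) :=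
    (convex_segment n w).isPreconnected.image _ (by fun_prop)
  refine hpre.subset_of_disjoint_frontier hQ ?_ ?_ ⟨w, right_mem_segment ℝ n w, rfl⟩
  · refine ⟨_, ⟨n, left_mem_segment ℝ n w, rfl⟩, ?_⟩
    convert hsQ using 1
    ext <;> simp [hn]
  · rintro _ ⟨z, hzs, rfl⟩ hfr
    obtain ⟨hz1, hz2⟩ := hz z hzs
    have hz0 : z ≠ 0 := by
      rintro rfl
      simp [dotp] at hz1
      linarith
    have hzpos : 0 < ‖z‖ := norm_pos_iff.2 hz0
    have hdist : dist (P + s • z) P = s * ‖z‖ := by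
      simp [dist_eq_norm, norm_smul, abs_of_pos hs0]
    have hne : P + s • z ≠ P := by simp [hs0.ne', hz0]
    have hlt : dist (P + s • z) P < δ := by
      rw [hdist]
      calc s * ‖z‖ < s * M := by gcongr
        _ < δ := by rwa [lt_div_iff₀ hM] at hsδ
    have := htan hlt ⟨hfr, hne⟩
    rw [hdist] at this
    simp only [Prod.snd_add, Prod.smul_snd, add_sub_cancel_left, dotp_smul_left] at this
    rw [mul_div_mul_left _ _ hs0.ne', div_lt_div_iff₀ hzpos hM] at this
    have h3 : m * ‖z‖ < m * M := by gcongr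
    have h4 : m * M ≤ dotp z.2 (ν P) * M := by gcongr
    linarith

/-- At a maximum over `Q ∪ Q0` on the degenerate boundary, derivatives of `u` in the directions
that do not point outwards are nonpositive. -/
theorem IsDegenBdry.directional_deriv_nonpos (h : IsDegenBdry Q a Q0 ν α) (hQ : IsOpen Q)
    (hP : P ∈ Q0) {u : Pt d → ℝ} (hu : IsC2s a u Q Q0) (hmax : ∀ R ∈ Q ∪ Q0, u R ≤ u P)
    {ℓ : ℝ} {g : Fin d → ℝ} (hℓ : Tendsto (tDeriv u) (𝓝[Q] P) (𝓝 ℓ))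
    (hg : Tendsto (xGrad u) (𝓝[Q] P) (𝓝 g)) {w : Pt d} (hw : 0 ≤ dotp w.2 (ν P)) :
    w.1 * ℓ + dotp w.2 g ≤ 0 := by
  have key : ∀ w : Pt d, 0 < dotp w.2 (ν P) → w.1 * ℓ + dotp w.2 g ≤ 0 := by
    intro w hw
    have hray := h.eventually_ray_mem hQ hP hw
    set s : Set ℝ := {r | P + r • w ∈ Q}
    have hcont : Tendsto (fun r : ℝ => P + r • w) (𝓝 0) (𝓝 P) := by
      have : Continuous (fun r : ℝ => P + r • w) := by fun_prop
      simpa using this.tendsto 0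
    have hlim : Tendsto (fun r : ℝ => P + r • w) (𝓝[>] 0) (𝓝[Q] P) :=
      tendsto_nhdsWithin_iff.2 ⟨hcont.mono_left nhdsWithin_le_nhds, hray⟩
    have hderiv : HasDerivWithinAt (fun r : ℝ => u (P + r • w)) (w.1 * ℓ + dotp w.2 g) (Ici 0) 0 := by
      refine hasDerivWithinAt_Ici_of_tendsto_deriv (s := s)
        (fun r hr => (hu.paraC2.hasDerivAt_line hQ hr).differentiableAt.differentiableWithinAt)
        ?_ hray ?_
      · have hc := hu.contu P (Or.inr hP)
        have ht : Tendsto (fun r : ℝ => P + r • w) (𝓝[s] 0) (𝓝[Q ∪ Q0] P) :=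
          tendsto_nhdsWithin_iff.2 ⟨hcont.mono_left nhdsWithin_le_nhds, by
            filter_upwards [self_mem_nhdsWithin] with r hr using Or.inl hr⟩
        simpa [ContinuousWithinAt, Function.comp_def] using hc.tendsto.comp ht
      · refine Tendsto.congr' ?_ (((hℓ.comp hlim).const_mul w.1).add
          (tendsto_dotp (tendsto_const_nhds (x := w.2)) (hg.comp hlim)))
        filter_upwards [hray] with r hr
        exact (hu.paraC2.hasDerivAt_line hQ hr).deriv.symm
    rw [hasDerivWithinAt_iff_tendsto_slope] at hderiv
    have hset : Ici (0 : ℝ) \ {0} = Ioi 0 := by simp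
    rw [hset] at hderiv
    refine le_of_tendsto hderiv ?_
    filter_upwards [hray, self_mem_nhdsWithin] with r hr (hr0 : 0 < r)
    have := hmax _ (Or.inl hr)
    simp only [slope_def_field, sub_zero, zero_smul, add_zero]
    exact div_nonpos_of_nonpos_of_nonneg (by linarith) hr0.le
  have hν : dotp (ν P) (ν P) = 1 := by rw [dotp_self, h.unitNormal P hP]
  have hpert : ∀ ε > 0, w.1 * ℓ + dotp w.2 g + ε * dotp (ν P) g ≤ 0 := fun ε hε => by
    have := key (w.1, w.2 + ε • ν P) (by simp only [dotp_add_left, dotp_smul_left, hν]; linarith)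
    simp only [dotp_add_left, dotp_smul_left] at this
    linarith
  have hlim : Tendsto (fun ε : ℝ => w.1 * ℓ + dotp w.2 g + ε * dotp (ν P) g) (𝓝[>] 0)
      (𝓝 (w.1 * ℓ + dotp w.2 g)) := by
    have : Continuous (fun ε : ℝ => w.1 * ℓ + dotp w.2 g + ε * dotp (ν P) g) := by fun_prop
    simpa using (this.tendsto 0).mono_left nhdsWithin_le_nhds
  exact le_of_tendsto hlim (by filter_upwards [self_mem_nhdsWithin] with ε hε using hpert ε hε)

/-- At a maximum on the degenerate boundary, the continuous extension of `Lu` is at least `cu`. -/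
theorem IsDegenBdry.exists_tendsto_Lop (h : IsDegenBdry Q a Q0 ν α) (hQ : IsOpen Q) (hP : P ∈ Q0)
    {u : Pt d → ℝ} (hu : IsC2s a u Q Q0) {b : Pt d → Fin d → ℝ} {c : Pt d → ℝ}
    (hb : ContinuousWithinAt b (Q ∪ Q0) P) (hc : ContinuousWithinAt c (Q ∪ Q0) P)
    (hbν : 0 ≤ dotp (b P) (ν P)) (hmax : ∀ R ∈ Q ∪ Q0, u R ≤ u P) :
    ∃ L, c P * u P ≤ L ∧ Tendsto (Lop a b c u) (𝓝[Q] P) (𝓝 L) := by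
  obtain ⟨ℓ, hℓ⟩ := hu.tLim P hP
  obtain ⟨g, hg⟩ := hu.xLim P hP
  have hsub : 𝓝[Q] P ≤ 𝓝[Q ∪ Q0] P := nhdsWithin_mono P subset_union_left
  refine ⟨-ℓ - 0 - dotp (b P) g + c P * u P, ?_, ((hℓ.neg.sub (hu.trLim P hP)).sub
    (tendsto_dotp (hb.tendsto.mono_left hsub) hg)).add
    ((hc.tendsto.mono_left hsub).mul ((hu.contu P (Or.inr hP)).tendsto.mono_left hsub))⟩
  have := h.directional_deriv_nonpos hQ hP hu hmax hℓ hg (w := (1, b P)) hbν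
  simp only [one_mul] at this
  linarith

end Boundary

/-- A special case of the strong maximum principle (Lemma 5.3). -/
theorem special_case_strong_max_principle
    {d : ℕ} (hd : 1 ≤ d) (Q Q0 : Set (Pt d))
    (a : Pt d → Matrix (Fin d) (Fin d) ℝ) (b : Pt d → Fin d → ℝ) (c : Pt d → ℝ)
    (ν : Pt d → Fin d → ℝ) (α : ℝ)
    (hQ : IsOpen Q) (ha : ∀ P ∈ Q, (a P).PosSemidef)
    (hQ0 : IsDegenBdry Q a Q0 ν α)
    (hbcont : ∀ P ∈ Q0, ContinuousWithinAt b (Q ∪ Q0) P)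
    (hccont : ∀ P ∈ Q0, ContinuousWithinAt c (Q ∪ Q0) P)
    (hbperp : ∀ P ∈ Q0, 0 ≤ dotp (b P) (ν P))
    (hcQ : ∀ P ∈ Q, 0 ≤ c P) (hcQ0 : ∀ P ∈ Q0, 0 ≤ c P)
    (u : Pt d → ℝ) (hu : IsC2s a u Q Q0)
    -- either `Lu < 0` on `Q̲` (using the continuous extension of `Lu` to `Q̲`), or
    -- `Lu ≤ 0` on `Q` and `c > 0` on `Q̲`:
    (hcase :
      ((∀ P ∈ Q, Lop a b c u P < 0) ∧
        (∀ P ∈ Q0, ∃ ℓ : ℝ, ℓ < 0 ∧ Filter.Tendsto (Lop a b c u) (𝓝[Q] P) (𝓝 ℓ))) ∨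
      ((∀ P ∈ Q, Lop a b c u P ≤ 0) ∧ (∀ P ∈ Q ∪ Q0, 0 < c P))) :
    ¬ ∃ P0 ∈ Q ∪ Q0, 0 < u P0 ∧ ∀ P ∈ Q ∪ Q0, u P ≤ u P0 := by
  rintro ⟨P, hP, hpos, hmax⟩
  rcases hP with hP | hP
  · have hloc : IsLocalMax u P := by
      filter_upwards [hQ.mem_nhds hP] with R hR using hmax R (Or.inl hR)
    have hL := mul_le_Lop_of_isLocalMax (b := b) (c := c) hQ hu.paraC2 hP (ha P hP) hloc
    rcases hcase with ⟨hneg, -⟩ | ⟨hle, hc⟩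
    · linarith [hneg P hP, mul_nonneg (hcQ P hP) hpos.le]
    · linarith [hle P hP, mul_pos (hc P (Or.inl hP)) hpos]
  · obtain ⟨L, hL, hlim⟩ := hQ0.exists_tendsto_Lop hQ hP hu (hbcont P hP) (hccont P hP)
      (hbperp P hP) hmax
    have : (𝓝[Q] P).NeBot :=
      mem_closure_iff_nhdsWithin_neBot.1 (frontier_subset_closure (hQ0.subset hP))
    rcases hcase with ⟨-, hneg⟩ | ⟨hle, hc⟩
    · obtain ⟨ℓ, hℓ, hlim'⟩ := hneg P hP
      rw [tendsto_nhds_unique hlim' hlim] at hℓ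
      linarith [mul_nonneg (hcQ0 P hP) hpos.le]
    · have : L ≤ 0 := le_of_tendsto hlim (by
        filter_upwards [self_mem_nhdsWithin] with R hR using hle R hR)
      linarith [mul_pos (hc P (Or.inr hP)) hpos]
end
end
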